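/- arXiv:1404.4203 — 2 statements merged into one kernel-verified Lean document; each statement's English description precedes it below -/
import Mathlib

section
/- Let U ∈ C₀^∞(K̄∖{0}) and V_t ∈ C^∞(K̄_t∖{0}) for t = 1,2. Then the following nonlocal Green formula holds: Σ_{t=1,2} ∫_{K_t} (−ΔU)·conj(V_t) dy + ∫_{γ₁} (U + α·U(χ₁₂ r, φ+φ₁₂))·conj(∂V₁/∂n₁) dγ + ∫_{γ₃} U·conj(∂V₂/∂n₃) dγ + ∫_{γ₂} (∂U/∂n₂)·(conj(V₁) − conj(V₂)) dγ = Σ_{t=1,2} ∫_{K_t} U·conj(−ΔV_t) dy + ∫_{γ₁} (∂U/∂n₁)·conj(V₁) dγ + ∫_{γ₃} (∂U/∂n₃)·conj(V₂) dγ + ∫_{γ₂} U·conj( ∂V₁/∂n₂ − ∂V₂/∂n₂ + α·χ'₂₁·(∂V₁/∂n₁)(χ'₂₁ r, φ+φ'₂₁) ) dγ. -/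
open MeasureTheory Real Set ComplexConjugate

noncomputable section

/-- Open plane sector `{(r cos θ, r sin θ) : r > 0, a < θ < b}` (polar coordinates). -/
def sector (a b : ℝ) : Set (ℝ × ℝ) :=
  {y | ∃ r θ : ℝ, 0 < r ∧ a < θ ∧ θ < b ∧ y = (r * Real.cos θ, r * Real.sin θ)}

/-- Directional derivative of `W` in the direction `v`. -/
def dd (W : ℝ × ℝ → ℂ) (v : ℝ × ℝ) (y : ℝ × ℝ) : ℂ := fderiv ℝ W y v

/-- Laplacian on `ℝ²`. -/
def lap (W : ℝ × ℝ → ℂ) (y : ℝ × ℝ) : ℂ :=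
  dd (dd W (1, 0)) (1, 0) y + dd (dd W (0, 1)) (0, 1) y

/-- Rotation by the angle `ψ` composed with dilation by the factor `χ`:
in polar coordinates `(r, φ) ↦ (χ r, φ + ψ)`. -/
def rotDil (χ ψ : ℝ) (y : ℝ × ℝ) : ℝ × ℝ :=
  (χ * (y.1 * Real.cos ψ - y.2 * Real.sin ψ), χ * (y.1 * Real.sin ψ + y.2 * Real.cos ψ))

/-- Arclength integral over the ray `φ = b`: `∫_{γ} h dγ = ∫₀^∞ h(r, b) dr`. -/
def rayInt (b : ℝ) (h : ℝ × ℝ → ℂ) : ℂ :=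
  ∫ r in Set.Ioi (0 : ℝ), h (r * Real.cos b, r * Real.sin b)

/-- `W` is smooth on an open neighbourhood of the set `s`
(the formalization of `W ∈ C^∞(s)` for a non-open `s`). -/
def SmoothNear (W : ℝ × ℝ → ℂ) (s : Set (ℝ × ℝ)) : Prop :=
  ∃ O : Set (ℝ × ℝ), IsOpen O ∧ s ⊆ O ∧ ContDiffOn ℝ (⊤ : ℕ∞) W O

theorem sector_eq_image (a b : ℝ) :
    sector a b = polarCoord.symm '' (Ioi (0 : ℝ) ×ˢ Ioo a b) := by
  ext y
  constructor
  · rintro ⟨r, θ, hr, ha, hb, rfl⟩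
    exact ⟨(r, θ), ⟨hr, ha, hb⟩, rfl⟩
  · rintro ⟨⟨r, θ⟩, ⟨hr, ha, hb⟩, rfl⟩
    exact ⟨r, θ, hr, ha, hb, rfl⟩

theorem injOn_polarCoord_symm {a b : ℝ} (hab : b - a ≤ 2 * π) :
    InjOn polarCoord.symm (Ioi (0 : ℝ) ×ˢ Ioo a b) := by
  rintro ⟨r, θ⟩ ⟨hr, ha, hb⟩ ⟨s, η⟩ ⟨hs, ha', hb'⟩ h
  simp only [mem_Ioi] at *
  have h1 : r * cos θ = s * cos η := congrArg Prod.fst h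
  have h2 : r * sin θ = s * sin η := congrArg Prod.snd h
  have e1 := sin_sq_add_cos_sq θ
  have e2 := sin_sq_add_cos_sq η
  have hrs : r = s := by
    have : r ^ 2 = s ^ 2 := by
      calc r ^ 2 = (r * cos θ) ^ 2 + (r * sin θ) ^ 2 := by linear_combination -r ^ 2 * e1
        _ = (s * cos η) ^ 2 + (s * sin η) ^ 2 := by rw [h1, h2]
        _ = s ^ 2 := by linear_combination s ^ 2 * e2
    exact (pow_left_inj₀ hr.le hs.le two_ne_zero).1 this
  subst hrs
  have h1' := mul_left_cancel₀ hr.ne' h1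
  have h2' := mul_left_cancel₀ hr.ne' h2
  have hc : cos (θ - η) = 1 := by
    rw [cos_sub, h1', h2']; linear_combination e2
  have := (cos_eq_one_iff_of_lt_of_lt (by linarith) (by linarith)).1 hc
  rw [sub_eq_zero.1 this]

theorem measurableSet_sector {a b : ℝ} (hab : b - a ≤ 2 * π) : MeasurableSet (sector a b) := by
  rw [sector_eq_image]
  exact (measurableSet_Ioi.prod measurableSet_Ioo).image_of_continuousOn_injOn
    continuous_polarCoord_symm.continuousOn (injOn_polarCoord_symm hab)

theorem polar_ne_zero {r : ℝ} (hr : 0 < r) (θ : ℝ) : ((r * cos θ, r * sin θ) : ℝ × ℝ) ≠ 0 := by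
  intro h
  have h1 : r * cos θ = 0 := congrArg Prod.fst h
  have h2 : r * sin θ = 0 := congrArg Prod.snd h
  have e1 := sin_sq_add_cos_sq θ
  simp only [mul_eq_zero, hr.ne', false_or] at h1 h2
  simp [h1, h2] at e1

theorem polar_mem_closure_sector {a b r θ : ℝ} (hab : a < b) (hr : 0 < r) (hθ : θ ∈ Icc a b) :
    (r * cos θ, r * sin θ) ∈ closure (sector a b) \ {0} := by
  refine ⟨?_, polar_ne_zero hr θ⟩
  rw [← closure_Ioo hab.ne] at hθ
  have hc : Continuous fun t : ℝ => (r * cos t, r * sin t) := by fun_prop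
  refine closure_mono ?_ (image_closure_subset_closure_image hc (mem_image_of_mem _ hθ))
  rintro _ ⟨t, ht, rfl⟩
  exact ⟨r, t, hr, ht.1, ht.2, rfl⟩

theorem sector_subset {a b : ℝ} (hab : a < b) : sector a b ⊆ closure (sector a b) \ {0} := by
  rintro y ⟨r, θ, hr, ha, hb, rfl⟩
  exact polar_mem_closure_sector hab hr ⟨ha.le, hb.le⟩

theorem sector_mono {a b c d : ℝ} (hac : c ≤ a) (hbd : b ≤ d) : sector a b ⊆ sector c d := by
  rintro y ⟨r, θ, hr, ha, hb, rfl⟩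
  exact ⟨r, θ, hr, hac.trans_lt ha, hb.trans_le hbd, rfl⟩

theorem SmoothNear.mono {W : ℝ × ℝ → ℂ} {s t : Set (ℝ × ℝ)} (h : SmoothNear W t) (hst : s ⊆ t) :
    SmoothNear W s := by
  obtain ⟨O, hO, htO, hW⟩ := h
  exact ⟨O, hO, hst.trans htO, hW⟩

theorem setIntegral_sector {a b : ℝ} (hab : b - a ≤ 2 * π) (f : ℝ × ℝ → ℂ) :
    ∫ y in sector a b, f y =
      ∫ p in Ioi (0 : ℝ) ×ˢ Ioo a b, p.1 • f (p.1 * cos p.2, p.1 * sin p.2) := by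
  have hm : MeasurableSet (Ioi (0 : ℝ) ×ˢ Ioo a b) := measurableSet_Ioi.prod measurableSet_Ioo
  rw [sector_eq_image, integral_image_eq_integral_abs_det_fderiv_smul volume hm
    (fun p _ => (hasFDerivAt_polarCoord_symm p).hasFDerivWithinAt) (injOn_polarCoord_symm hab)]
  refine setIntegral_congr_fun hm fun p hp => ?_
  simp only [det_fderivPolarCoordSymm, abs_of_pos (show 0 < p.1 from hp.1)]
  rfl

theorem exists_radii {T : Set (ℝ × ℝ)} (hT : IsCompact T) (h0 : (0 : ℝ × ℝ) ∉ T) :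
    ∃ ε R : ℝ, 0 < ε ∧ ε < R ∧
      ∀ r θ : ℝ, 0 < r → r ∉ Ioo ε R → (r * cos θ, r * sin θ) ∉ T := by
  obtain ⟨δ, hδ, hδT⟩ := Metric.isOpen_iff.1 hT.isClosed.isOpen_compl 0 h0
  obtain ⟨C, hC⟩ := hT.isBounded.exists_norm_le
  refine ⟨δ / 2, max δ (2 * C + 1), by positivity, by
    have := le_max_left δ (2 * C + 1); linarith, fun r θ hr hr' hmem => hr' ⟨?_, ?_⟩⟩
  · by_contra! hle
    refine hδT ?_ hmem
    rw [mem_ball_zero_iff, Prod.norm_def, max_lt_iff]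
    simp only [norm_mul, norm_eq_abs, abs_of_pos hr]
    constructor
    · nlinarith [abs_cos_le_one θ, abs_nonneg (cos θ)]
    · nlinarith [abs_sin_le_one θ, abs_nonneg (sin θ)]
  · refine lt_max_of_lt_right ?_
    have h := hC _ hmem
    rw [Prod.norm_def, max_le_iff] at h
    simp only [norm_mul, norm_eq_abs, abs_of_pos hr] at h
    have e : 1 ≤ |cos θ| + |sin θ| := by
      nlinarith [abs_cos_le_one θ, abs_sin_le_one θ, sin_sq_add_cos_sq θ, sq_abs (cos θ),
        sq_abs (sin θ), abs_nonneg (cos θ), abs_nonneg (sin θ)]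
    nlinarith

theorem integrableOn_ray {h : ℝ × ℝ → ℂ} {T : Set (ℝ × ℝ)} {b : ℝ} (hT : IsCompact T)
    (h0 : (0 : ℝ × ℝ) ∉ T) (hz : ∀ y ∉ T, h y = 0)
    (hc : ContinuousOn (fun r : ℝ => h (r * cos b, r * sin b)) (Ioi 0)) :
    IntegrableOn (fun r : ℝ => h (r * cos b, r * sin b)) (Ioi 0) := by
  obtain ⟨ε, R, hε, -, hR⟩ := exists_radii hT h0
  have h1 : IntegrableOn (fun r : ℝ => h (r * cos b, r * sin b)) (Icc ε R) :=
    (hc.mono fun r hr => hε.trans_le hr.1).integrableOn_compact isCompact_Icc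
  refine h1.of_forall_sdiff_eq_zero measurableSet_Ioi fun r hr => hz _ (hR r b hr.1 ?_)
  exact fun h => hr.2 (Ioo_subset_Icc_self h)

theorem rayInt_eq_intervalIntegral {h : ℝ × ℝ → ℂ} {ε R b : ℝ} (hε : 0 < ε) (hεR : ε < R)
    (hz : ∀ r : ℝ, 0 < r → r ∉ Ioo ε R → h (r * cos b, r * sin b) = 0) :
    rayInt b h = ∫ r in ε..R, h (r * cos b, r * sin b) := by
  rw [intervalIntegral.integral_of_le hεR.le, rayInt]
  refine setIntegral_eq_of_subset_of_forall_sdiff_eq_zero measurableSet_Ioi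
    (fun r hr => hε.trans hr.1) fun r hr => hz r hr.1 fun h => hr.2 (Ioo_subset_Ioc_self h)

theorem integrableOn_sector {f : ℝ × ℝ → ℂ} {a b : ℝ} {O T : Set (ℝ × ℝ)} (hab : b - a ≤ 2 * π)
    (hT : IsCompact T) (h0 : (0 : ℝ × ℝ) ∉ T) (hz : ∀ y ∉ T, f y = 0)
    (hO : closure (sector a b) \ {0} ⊆ O) (hf : ContinuousOn f O) :
    IntegrableOn f (sector a b) := by
  have h1 : IntegrableOn f (T ∩ closure (sector a b)) := by
    refine (hf.mono fun y hy => hO ⟨hy.2, ?_⟩).integrableOn_compact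
      (hT.inter_right isClosed_closure)
    rintro rfl
    exact h0 hy.1
  refine h1.of_forall_sdiff_eq_zero (measurableSet_sector hab) fun y hy => hz y fun hyT => ?_
  exact hy.2 ⟨hyT, subset_closure hy.1⟩

theorem ContDiffOn.dd {W : ℝ × ℝ → ℂ} {O : Set (ℝ × ℝ)} (hO : IsOpen O)
    (hW : ContDiffOn ℝ (⊤ : ℕ∞) W O) (v : ℝ × ℝ) : ContDiffOn ℝ (⊤ : ℕ∞) (dd W v) O :=
  (hW.fderiv_of_isOpen hO (by simp)).clm_apply contDiffOn_const

theorem dd_eq_zero_of_forall_notMem {W : ℝ × ℝ → ℂ} {T : Set (ℝ × ℝ)} (hT : IsClosed T)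
    (hz : ∀ y ∉ T, W y = 0) (v : ℝ × ℝ) : ∀ y ∉ T, dd W v y = 0 := by
  intro y hy
  have h : W =ᶠ[nhds y] fun _ => 0 :=
    Filter.eventually_of_mem (hT.isOpen_compl.mem_nhds hy) fun z hz' => hz z hz'
  simp [dd, h.fderiv_eq]

theorem dd_mk (W : ℝ × ℝ → ℂ) (s c : ℝ) (y : ℝ × ℝ) :
    dd W (s, c) y = s * dd W (1, 0) y + c * dd W (0, 1) y := by
  have : ((s, c) : ℝ × ℝ) = s • (1, 0) + c • (0, 1) := by simp
  simp only [dd]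
  rw [this, map_add, map_smul, map_smul, Complex.real_smul, Complex.real_smul]

theorem dd_conj (W : ℝ × ℝ → ℂ) (v : ℝ × ℝ) :
    dd (fun y => conj (W y)) v = fun y => conj (dd W v y) := by
  ext y
  have h := Complex.conjCLE.comp_fderiv (f := W) (x := y)
  have h' : fderiv ℝ (fun y => conj (W y)) y = (Complex.conjCLE : ℂ →L[ℝ] ℂ).comp (fderiv ℝ W y) :=
    h
  simp [dd, h']

theorem lap_conj (W : ℝ × ℝ → ℂ) (y : ℝ × ℝ) :
    lap (fun y => conj (W y)) y = conj (lap W y) := by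
  simp only [lap, dd_conj, map_add]

/-- The divergence theorem in a plane sector, for a vector field vanishing near the vertex and
near infinity. -/
theorem integral_div_sector {F G : ℝ × ℝ → ℂ} {a b : ℝ} {O T : Set (ℝ × ℝ)} (hab : a < b)
    (hab' : b - a ≤ 2 * π) (hT : IsCompact T) (h0 : (0 : ℝ × ℝ) ∉ T)
    (hFz : ∀ y ∉ T, F y = 0) (hGz : ∀ y ∉ T, G y = 0)
    (hO : IsOpen O) (hsO : closure (sector a b) \ {0} ⊆ O)
    (hF : ContDiffOn ℝ (⊤ : ℕ∞) F O) (hG : ContDiffOn ℝ (⊤ : ℕ∞) G O) :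
    ∫ y in sector a b, (dd F (1, 0) y + dd G (0, 1) y) =
      rayInt b (fun y => -sin b * F y + cos b * G y) -
        rayInt a (fun y => -sin a * F y + cos a * G y) := by
  obtain ⟨ε, R, hε, hεR, hR⟩ := exists_radii hT h0
  have hFd := dd_eq_zero_of_forall_notMem hT.isClosed hFz
  have hGd := dd_eq_zero_of_forall_notMem hT.isClosed hGz
  have hmem : ∀ p ∈ Icc ((ε, a) : ℝ × ℝ) (R, b), (p.1 * cos p.2, p.1 * sin p.2) ∈ O :=
    fun p hp => hsO (polar_mem_closure_sector hab (hε.trans_le hp.1.1) ⟨hp.1.2, hp.2.2⟩)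
  have hPc : ContinuousOn (fun p : ℝ × ℝ => (p.1 * cos p.2, p.1 * sin p.2))
      (Icc ((ε, a) : ℝ × ℝ) (R, b)) := by fun_prop
  have hcomp : ∀ {f : ℝ × ℝ → ℂ}, ContDiffOn ℝ (⊤ : ℕ∞) f O →
      ContinuousOn (fun p : ℝ × ℝ => f (p.1 * cos p.2, p.1 * sin p.2))
        (Icc ((ε, a) : ℝ × ℝ) (R, b)) := fun hf => hf.continuousOn.comp hPc hmem
  have hFc := hcomp hF
  have hGc := hcomp hG
  let A : ℝ × ℝ → ℂ := fun p => p.1 * (cos p.2 * F (p.1 * cos p.2, p.1 * sin p.2) +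
    sin p.2 * G (p.1 * cos p.2, p.1 * sin p.2))
  let B : ℝ × ℝ → ℂ := fun p => -sin p.2 * F (p.1 * cos p.2, p.1 * sin p.2) +
    cos p.2 * G (p.1 * cos p.2, p.1 * sin p.2)
  have hbox : ∀ p ∈ Ioo ε R ×ˢ Ioo a b, p ∈ Icc ((ε, a) : ℝ × ℝ) (R, b) :=
    fun p hp => ⟨⟨hp.1.1.le, hp.2.1.le⟩, ⟨hp.1.2.le, hp.2.2.le⟩⟩
  have hFat : ∀ p ∈ Ioo ε R ×ˢ Ioo a b,
      DifferentiableAt ℝ F (p.1 * cos p.2, p.1 * sin p.2) := fun p hp =>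
    (hF.contDiffAt (hO.mem_nhds (hmem p (hbox p hp)))).differentiableAt (by simp)
  have hGat : ∀ p ∈ Ioo ε R ×ˢ Ioo a b,
      DifferentiableAt ℝ G (p.1 * cos p.2, p.1 * sin p.2) := fun p hp =>
    (hG.contDiffAt (hO.mem_nhds (hmem p (hbox p hp)))).differentiableAt (by simp)
  have hPd : ∀ p : ℝ × ℝ,
      DifferentiableAt ℝ (fun p : ℝ × ℝ => (p.1 * cos p.2, p.1 * sin p.2)) p := by
    intro p; fun_prop
  have hofReal : Differentiable ℝ ((↑) : ℝ → ℂ) := Complex.ofRealCLM.differentiable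
  have hFP : ∀ p ∈ Ioo ε R ×ˢ Ioo a b,
      DifferentiableAt ℝ (fun p : ℝ × ℝ => F (p.1 * cos p.2, p.1 * sin p.2)) p :=
    fun p hp => (hFat p hp).comp p (hPd p)
  have hGP : ∀ p ∈ Ioo ε R ×ˢ Ioo a b,
      DifferentiableAt ℝ (fun p : ℝ × ℝ => G (p.1 * cos p.2, p.1 * sin p.2)) p :=
    fun p hp => (hGat p hp).comp p (hPd p)
  have hAd : ∀ p ∈ Ioo ε R ×ˢ Ioo a b, DifferentiableAt ℝ A p := by
    intro p hp
    have := hFP p hp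
    have := hGP p hp
    have h1 : DifferentiableAt ℝ (fun p : ℝ × ℝ => ((p.1 : ℝ) : ℂ)) p :=
      (hofReal _).comp p differentiableAt_fst
    have h2 : DifferentiableAt ℝ (fun p : ℝ × ℝ => ((cos p.2 : ℝ) : ℂ)) p :=
      (hofReal _).comp p (by fun_prop)
    have h3 : DifferentiableAt ℝ (fun p : ℝ × ℝ => ((sin p.2 : ℝ) : ℂ)) p :=
      (hofReal _).comp p (by fun_prop)
    fun_prop
  have hBd : ∀ p ∈ Ioo ε R ×ˢ Ioo a b, DifferentiableAt ℝ B p := by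
    intro p hp
    have := hFP p hp
    have := hGP p hp
    have h2 : DifferentiableAt ℝ (fun p : ℝ × ℝ => ((cos p.2 : ℝ) : ℂ)) p :=
      (hofReal _).comp p (by fun_prop)
    have h3 : DifferentiableAt ℝ (fun p : ℝ × ℝ => ((sin p.2 : ℝ) : ℂ)) p :=
      (hofReal _).comp p (by fun_prop)
    fun_prop
  have hdiv : ∀ p ∈ Ioo ε R ×ˢ Ioo a b, fderiv ℝ A p (1, 0) + fderiv ℝ B p (0, 1) =
      p.1 • (dd F (1, 0) (p.1 * cos p.2, p.1 * sin p.2) +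
        dd G (0, 1) (p.1 * cos p.2, p.1 * sin p.2)) := by
    rintro ⟨r, θ⟩ hp
    have hA1 : HasDerivAt (fun t : ℝ => A (t, θ)) (fderiv ℝ A (r, θ) (1, 0)) r :=
      HasFDerivAt.comp_hasDerivAt (l := A) (f := fun t : ℝ => (t, θ)) r (hAd _ hp).hasFDerivAt
        ((hasDerivAt_id' r).prodMk (hasDerivAt_const r θ))
    have hB1 : HasDerivAt (fun t : ℝ => B (r, t)) (fderiv ℝ B (r, θ) (0, 1)) θ :=
      (hBd _ hp).hasFDerivAt.comp_hasDerivAt θ ((hasDerivAt_const θ r).prodMk (hasDerivAt_id' θ))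
    have hPr : HasDerivAt (fun t : ℝ => (t * cos θ, t * sin θ)) (cos θ, sin θ) r := by
      simpa using ((hasDerivAt_id r).mul_const (cos θ)).prodMk
        ((hasDerivAt_id r).mul_const (sin θ))
    have hPθ : HasDerivAt (fun t : ℝ => (r * cos t, r * sin t)) (r * -sin θ, r * cos θ) θ :=
      ((hasDerivAt_cos θ).const_mul r).prodMk ((hasDerivAt_sin θ).const_mul r)
    have hFr := (hFat _ hp).hasFDerivAt.comp_hasDerivAt r hPr
    have hGr := (hGat _ hp).hasFDerivAt.comp_hasDerivAt r hPr
    have hFθ := (hFat _ hp).hasFDerivAt.comp_hasDerivAt θ hPθ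
    have hGθ := (hGat _ hp).hasFDerivAt.comp_hasDerivAt θ hPθ
    have hA2 := (hasDerivAt_id r).ofReal_comp.mul
      ((hFr.const_mul (cos θ : ℂ)).add (hGr.const_mul (sin θ : ℂ)))
    have hB2 := ((hasDerivAt_sin θ).ofReal_comp.neg.mul hFθ).add
      ((hasDerivAt_cos θ).ofReal_comp.mul hGθ)
    rw [hA1.unique hA2, hB1.unique hB2]
    change _ * _ + _ * (_ * dd F (cos θ, sin θ) _ + _ * dd G (cos θ, sin θ) _) +
      (_ + _ * dd F (r * -sin θ, r * cos θ) _ + (_ + _ * dd G (r * -sin θ, r * cos θ) _)) = _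
    rw [dd_mk F (cos θ), dd_mk G (cos θ), dd_mk F (r * -sin θ), dd_mk G (r * -sin θ)]
    have e : (sin θ : ℂ) ^ 2 + (cos θ : ℂ) ^ 2 = 1 := by exact_mod_cast sin_sq_add_cos_sq θ
    simp only [Function.comp_apply, id, Pi.add_apply, Pi.neg_apply, Complex.real_smul,
      Complex.ofReal_neg, Complex.ofReal_mul, Complex.ofReal_one]
    linear_combination (r : ℂ) * (dd F (1, 0) (r * cos θ, r * sin θ) +
      dd G (0, 1) (r * cos θ, r * sin θ)) * e
  have hae : (Ioo ε R ×ˢ Ioo a b : Set (ℝ × ℝ)) =ᵐ[volume] Icc ((ε, a) : ℝ × ℝ) (R, b) := by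
    rw [← Icc_prod_Icc]
    exact Measure.set_prod_ae_eq Ioo_ae_eq_Icc Ioo_ae_eq_Icc
  have hmO : MeasurableSet (Ioo ε R ×ˢ Ioo a b : Set (ℝ × ℝ)) :=
    measurableSet_Ioo.prod measurableSet_Ioo
  have hint : IntegrableOn (fun p => fderiv ℝ A p (1, 0) + fderiv ℝ B p (0, 1))
      (Icc ((ε, a) : ℝ × ℝ) (R, b)) := by
    have hD : IntegrableOn (fun p : ℝ × ℝ => p.1 • (dd F (1, 0) (p.1 * cos p.2, p.1 * sin p.2) +
        dd G (0, 1) (p.1 * cos p.2, p.1 * sin p.2))) (Icc ((ε, a) : ℝ × ℝ) (R, b)) :=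
      (continuousOn_fst.smul ((hcomp (hF.dd hO _)).add (hcomp (hG.dd hO _)))).integrableOn_compact
        isCompact_Icc
    exact ((hD.mono_set hbox).congr_fun (fun p hp => (hdiv p hp).symm) hmO).congr_set_ae hae.symm
  have hccos : Continuous fun p : ℝ × ℝ => ((cos p.2 : ℝ) : ℂ) :=
    Complex.continuous_ofReal.comp (by fun_prop)
  have hcsin : Continuous fun p : ℝ × ℝ => ((sin p.2 : ℝ) : ℂ) :=
    Complex.continuous_ofReal.comp (by fun_prop)
  have hcfst : Continuous fun p : ℝ × ℝ => ((p.1 : ℝ) : ℂ) :=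
    Complex.continuous_ofReal.comp continuous_fst
  have hAc : ContinuousOn A (Icc ((ε, a) : ℝ × ℝ) (R, b)) :=
    hcfst.continuousOn.mul ((hccos.continuousOn.mul hFc).add (hcsin.continuousOn.mul hGc))
  have hBc : ContinuousOn B (Icc ((ε, a) : ℝ × ℝ) (R, b)) :=
    (hcsin.neg.continuousOn.mul hFc).add (hccos.continuousOn.mul hGc)
  have hmain := integral_divergence_prod_Icc_of_hasFDerivAt_of_le A B (fderiv ℝ A) (fderiv ℝ B)
    (ε, a) (R, b) ⟨hεR.le, hab.le⟩ hAc hBc (fun p hp => (hAd p hp).hasFDerivAt)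
    (fun p hp => (hBd p hp).hasFDerivAt) hint
  have hAz : ∀ r θ : ℝ, 0 < r → r ∉ Ioo ε R → A (r, θ) = 0 := by
    intro r θ hr hr'
    simp only [A, hFz _ (hR r θ hr hr'), hGz _ (hR r θ hr hr'), mul_zero, add_zero]
  have hAε : ∀ θ, A (ε, θ) = 0 := fun θ => hAz ε θ hε fun h => lt_irrefl _ h.1
  have hAR : ∀ θ, A (R, θ) = 0 := fun θ => hAz R θ (hε.trans hεR) fun h => lt_irrefl _ h.2
  have hsub : Ioo ε R ×ˢ Ioo a b ⊆ Ioi (0 : ℝ) ×ˢ Ioo a b :=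
    prod_mono (fun r hr => hε.trans hr.1) subset_rfl
  rw [setIntegral_sector hab', setIntegral_eq_of_subset_of_forall_sdiff_eq_zero
    (measurableSet_Ioi.prod measurableSet_Ioo) hsub, ← setIntegral_congr_fun hmO hdiv,
    setIntegral_congr_set hae, hmain]
  · simp only [hAε, hAR, intervalIntegral.integral_zero, add_zero, sub_zero]
    rw [rayInt_eq_intervalIntegral hε hεR, rayInt_eq_intervalIntegral hε hεR]
    · intro r hr hr'
      simp only [hFz _ (hR r a hr hr'), hGz _ (hR r a hr hr'), mul_zero, add_zero]
    · intro r hr hr'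
      simp only [hFz _ (hR r b hr hr'), hGz _ (hR r b hr hr'), mul_zero, add_zero]
  · rintro ⟨r, θ⟩ ⟨hp, hp'⟩
    have hr' : r ∉ Ioo ε R := fun h => hp' ⟨h, hp.2⟩
    simp only [hFd _ _ (hR r θ hp.1 hr'), hGd _ _ (hR r θ hp.1 hr'), add_zero, smul_zero]

/-- Green's second identity in a plane sector. -/
theorem green_sector {U W : ℝ × ℝ → ℂ} {a b : ℝ} (hab : a < b) (hab' : b - a ≤ 2 * π)
    (hUc : HasCompactSupport U) (hU0 : (0 : ℝ × ℝ) ∉ tsupport U)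
    (hU : SmoothNear U (closure (sector a b) \ {0}))
    (hW : SmoothNear W (closure (sector a b) \ {0})) :
    ∫ y in sector a b, (lap U y * W y - U y * lap W y) =
      rayInt b (fun y => dd U (-sin b, cos b) y * W y - U y * dd W (-sin b, cos b) y) -
        rayInt a (fun y => dd U (-sin a, cos a) y * W y - U y * dd W (-sin a, cos a) y) := by
  obtain ⟨O₁, hO₁, hs₁, hU⟩ := hU
  obtain ⟨O₂, hO₂, hs₂, hW⟩ := hW
  have hO := hO₁.inter hO₂
  have hs := subset_inter hs₁ hs₂
  replace hU := hU.mono (inter_subset_left (t := O₂))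
  replace hW := hW.mono (inter_subset_right (s := O₁))
  have hz : ∀ y ∉ tsupport U, U y = 0 := fun y hy => image_eq_zero_of_notMem_tsupport hy
  have hdz := dd_eq_zero_of_forall_notMem (isClosed_tsupport U) hz
  have hFz : ∀ v, ∀ y ∉ tsupport U, dd U v y * W y - U y * dd W v y = 0 := fun v y hy => by
    rw [hz y hy, hdz v y hy]; ring
  have hF : ∀ v, ContDiffOn ℝ (⊤ : ℕ∞) (fun y => dd U v y * W y - U y * dd W v y) (O₁ ∩ O₂) :=
    fun v => ((hU.dd hO v).mul hW).sub (hU.mul (hW.dd hO v))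
  have key := integral_div_sector hab hab' hUc hU0 (hFz (1, 0)) (hFz (0, 1)) hO hs (hF _) (hF _)
  have hdd : ∀ y ∈ O₁ ∩ O₂, ∀ v, dd (fun y => dd U v y * W y - U y * dd W v y) v y =
      dd (dd U v) v y * W y - U y * dd (dd W v) v y := by
    intro y hy v
    have hd : ∀ {f : ℝ × ℝ → ℂ}, ContDiffOn ℝ (⊤ : ℕ∞) f (O₁ ∩ O₂) →
        HasFDerivAt f (fderiv ℝ f y) y := fun hf =>
      ((hf.contDiffAt (hO.mem_nhds hy)).differentiableAt (by simp)).hasFDerivAt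
    have h := ((hd (hU.dd hO v)).mul (hd hW)).sub ((hd hU).mul (hd (hW.dd hO v)))
    have h' : fderiv ℝ (fun y => dd U v y * W y - U y * dd W v y) y = _ := h.fderiv
    rw [dd, h']
    simp only [dd, sub_apply, add_apply, smul_apply, smul_eq_mul]
    ring
  rw [setIntegral_congr_fun (measurableSet_sector hab') (g := fun y => _) fun y hy => ?_, key]
  · congr 2 <;>
    · ext y
      simp only [dd_mk _ (-sin _), Complex.ofReal_neg]
      ring
  · have hyO := hs (sector_subset hab hy)
    simp only [hdd y hyO, lap]
    ring

theorem SmoothNear.conj {W : ℝ × ℝ → ℂ} {s : Set (ℝ × ℝ)} (h : SmoothNear W s) :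
    SmoothNear (fun y => conj (W y)) s := by
  obtain ⟨O, hO, hs, hW⟩ := h
  exact ⟨O, hO, hs, Complex.conjCLE.contDiff.comp_contDiffOn hW⟩

theorem SmoothNear.dd {W : ℝ × ℝ → ℂ} {s : Set (ℝ × ℝ)} (h : SmoothNear W s) (v : ℝ × ℝ) :
    SmoothNear (dd W v) s := by
  obtain ⟨O, hO, hs, hW⟩ := h
  exact ⟨O, hO, hs, hW.dd hO v⟩

theorem SmoothNear.continuousOn {W : ℝ × ℝ → ℂ} {s : Set (ℝ × ℝ)} (h : SmoothNear W s) :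
    ContinuousOn W s := by
  obtain ⟨O, -, hs, hW⟩ := h
  exact hW.continuousOn.mono hs

theorem SmoothNear.continuousOn_lap {W : ℝ × ℝ → ℂ} {s : Set (ℝ × ℝ)} (h : SmoothNear W s) :
    ContinuousOn (lap W) s :=
  ((h.dd _).dd _).continuousOn.add ((h.dd _).dd _).continuousOn

theorem continuousOn_ray {f : ℝ × ℝ → ℂ} {a b θ : ℝ} (hab : a < b) (hθ : θ ∈ Icc a b)
    (hf : ContinuousOn f (closure (sector a b) \ {0})) :
    ContinuousOn (fun r : ℝ => f (r * cos θ, r * sin θ)) (Ioi 0) :=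
  hf.comp (by fun_prop) fun _ hr => polar_mem_closure_sector hab hr hθ

theorem integrableOn_ray_mul {f g : ℝ × ℝ → ℂ} {T : Set (ℝ × ℝ)} {a b θ : ℝ} (hT : IsCompact T)
    (h0 : (0 : ℝ × ℝ) ∉ T) (hz : ∀ y ∉ T, f y = 0) (hab : a < b) (hθ : θ ∈ Icc a b)
    (hf : ContinuousOn f (closure (sector a b) \ {0}))
    (hg : ContinuousOn g (closure (sector a b) \ {0})) :
    IntegrableOn (fun r : ℝ => f (r * cos θ, r * sin θ) * g (r * cos θ, r * sin θ)) (Ioi 0) :=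
  integrableOn_ray (h := fun y => f y * g y) hT h0 (fun y hy => by simp [hz y hy])
    (continuousOn_ray hab hθ (hf.mul hg))

/-- Green's second identity in a plane sector, in sesquilinear form. -/
theorem green_sector_conj {U V : ℝ × ℝ → ℂ} {a b : ℝ} (hab : a < b) (hab' : b - a ≤ 2 * π)
    (hUc : HasCompactSupport U) (hU0 : (0 : ℝ × ℝ) ∉ tsupport U)
    (hU : SmoothNear U (closure (sector a b) \ {0}))
    (hV : SmoothNear V (closure (sector a b) \ {0})) :
    (∫ y in sector a b, (-(lap U y)) * conj (V y)) +
        rayInt b (fun y => dd U (-sin b, cos b) y * conj (V y)) +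
        rayInt a (fun y => U y * conj (dd V (-sin a, cos a) y)) =
      (∫ y in sector a b, U y * conj (-(lap V y))) +
        rayInt a (fun y => dd U (-sin a, cos a) y * conj (V y)) +
        rayInt b (fun y => U y * conj (dd V (-sin b, cos b) y)) := by
  have key := green_sector hab hab' hUc hU0 hU hV.conj
  have hz : ∀ y ∉ tsupport U, U y = 0 := fun y hy => image_eq_zero_of_notMem_tsupport hy
  have hdz := dd_eq_zero_of_forall_notMem (isClosed_tsupport U) hz
  have hlz : ∀ y ∉ tsupport U, lap U y = 0 := fun y hy => by
    have h := dd_eq_zero_of_forall_notMem (isClosed_tsupport U) (hdz (1, 0)) (1, 0) y hy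
    have h' := dd_eq_zero_of_forall_notMem (isClosed_tsupport U) (hdz (0, 1)) (0, 1) y hy
    rw [lap, h, h', add_zero]
  simp only [dd_conj, lap_conj] at key
  have i1 : IntegrableOn (fun y => lap U y * conj (V y)) (sector a b) :=
    integrableOn_sector hab' hUc hU0 (fun y hy => by simp [hlz y hy]) subset_rfl
      (hU.continuousOn_lap.mul hV.conj.continuousOn)
  have i2 : IntegrableOn (fun y => U y * conj (lap V y)) (sector a b) :=
    integrableOn_sector hab' hUc hU0 (fun y hy => by simp [hz y hy]) subset_rfl
      (hU.continuousOn.mul (Complex.continuous_conj.comp_continuousOn hV.continuousOn_lap))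
  have r1 : ∀ θ ∈ Icc a b, rayInt θ (fun y => dd U (-sin θ, cos θ) y * conj (V y) -
      U y * conj (dd V (-sin θ, cos θ) y)) =
      rayInt θ (fun y => dd U (-sin θ, cos θ) y * conj (V y)) -
        rayInt θ (fun y => U y * conj (dd V (-sin θ, cos θ) y)) := fun θ hθ =>
    integral_sub (integrableOn_ray_mul hUc hU0 (hdz _) hab hθ (hU.dd _).continuousOn
      hV.conj.continuousOn)
      (integrableOn_ray_mul hUc hU0 hz hab hθ hU.continuousOn (hV.dd _).conj.continuousOn)
  rw [r1 a ⟨le_rfl, hab.le⟩, r1 b ⟨hab.le, le_rfl⟩, integral_sub i1 i2] at key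
  simp only [neg_mul, map_neg, mul_neg, integral_neg]
  linear_combination -key

theorem rotDil_polar (χ ψ r θ : ℝ) :
    rotDil χ ψ (r * cos θ, r * sin θ) = (χ * r * cos (θ + ψ), χ * r * sin (θ + ψ)) := by
  rw [rotDil, cos_add, sin_add]
  ext <;> ring

/-- Change of variables between two rays related by a rotation and a dilation. -/
theorem rayInt_comp_rotDil {χ : ℝ} (hχ : 0 < χ) (a b : ℝ) (f g : ℝ × ℝ → ℂ) :
    rayInt a (fun y => f (rotDil χ (b - a) y) * g y) =
      rayInt b (fun y => ((1 / χ : ℝ) : ℂ) * (f y * g (rotDil (1 / χ) (-(b - a)) y))) := by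
  have h := integral_comp_mul_left_Ioi (fun s : ℝ => ((1 / χ : ℝ) : ℂ) *
    (f (s * cos b, s * sin b) * g (rotDil (1 / χ) (-(b - a)) (s * cos b, s * sin b)))) 0 hχ
  rw [mul_zero, eq_inv_smul_iff₀ hχ.ne', ← integral_smul] at h
  rw [rayInt, rayInt, ← h]
  congr 1
  ext r
  have e : 1 / χ * (χ * r) = r := by field_simp
  have e' : (χ : ℂ) ≠ 0 := by exact_mod_cast hχ.ne'
  rw [rotDil_polar, rotDil_polar, e, add_sub_cancel, neg_sub, add_sub_cancel, Complex.real_smul]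
  push_cast
  field_simp

/-- Nonlocal Green formula for `-Δ` in the plane angle `K` with the nonlocal
Dirichlet-type boundary operator `U|_{γ₁} + α U(χ₁₂ r, φ + φ₁₂)|_{γ₁}` (Example 1). -/
theorem green_formula_nonlocal_dirichlet
    (b₁ b₂ b₃ : ℝ) (hb₀ : 0 < b₁) (hb₁₂ : b₁ < b₂) (hb₂₃ : b₂ < b₃) (hb₃ : b₃ < 2 * π)
    (α χ₁₂ : ℝ) (hχ : 0 < χ₁₂)
    (U V₁ V₂ : ℝ × ℝ → ℂ)
    (hU : SmoothNear U (closure (sector b₁ b₃) \ {0}))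
    (hUc : HasCompactSupport U) (hU0 : (0 : ℝ × ℝ) ∉ tsupport U)
    (hV₁ : SmoothNear V₁ (closure (sector b₁ b₂) \ {0}))
    (hV₂ : SmoothNear V₂ (closure (sector b₂ b₃) \ {0})) :
    ((∫ y in sector b₁ b₂, (-(lap U y)) * conj (V₁ y)) +
      (∫ y in sector b₂ b₃, (-(lap U y)) * conj (V₂ y))) +
    rayInt b₁ (fun y => (U y + (α : ℂ) * U (rotDil χ₁₂ (b₂ - b₁) y)) *
      conj (dd V₁ (-Real.sin b₁, Real.cos b₁) y)) +
    rayInt b₃ (fun y => U y * conj (dd V₂ (Real.sin b₃, -Real.cos b₃) y)) +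
    rayInt b₂ (fun y => dd U (-Real.sin b₂, Real.cos b₂) y * (conj (V₁ y) - conj (V₂ y))) =
    ((∫ y in sector b₁ b₂, U y * conj (-(lap V₁ y))) +
      (∫ y in sector b₂ b₃, U y * conj (-(lap V₂ y)))) +
    rayInt b₁ (fun y => dd U (-Real.sin b₁, Real.cos b₁) y * conj (V₁ y)) +
    rayInt b₃ (fun y => dd U (Real.sin b₃, -Real.cos b₃) y * conj (V₂ y)) +
    rayInt b₂ (fun y => U y * conj (dd V₁ (-Real.sin b₂, Real.cos b₂) y -
      dd V₂ (-Real.sin b₂, Real.cos b₂) y +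
      (α : ℂ) * ((1 / χ₁₂ : ℝ) : ℂ) *
        dd V₁ (-Real.sin b₁, Real.cos b₁) (rotDil (1 / χ₁₂) (-(b₂ - b₁)) y))) := by
  have hπ₁ : b₂ - b₁ ≤ 2 * π := by linarith
  have hπ₂ : b₃ - b₂ ≤ 2 * π := by linarith
  have hU₁ := hU.mono (sdiff_subset_sdiff_left
    (closure_mono (sector_mono (a := b₁) (b := b₂) le_rfl hb₂₃.le)))
  have hU₂ := hU.mono (sdiff_subset_sdiff_left
    (closure_mono (sector_mono (a := b₂) (b := b₃) hb₁₂.le le_rfl)))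
  have key₁ := green_sector_conj hb₁₂ hπ₁ hUc hU0 hU₁ hV₁
  have key₂ := green_sector_conj hb₂₃ hπ₂ hUc hU0 hU₂ hV₂
  have hz : ∀ y ∉ tsupport U, U y = 0 := fun y hy => image_eq_zero_of_notMem_tsupport hy
  have hdz := dd_eq_zero_of_forall_notMem (isClosed_tsupport U) hz
  have m₁ : b₁ ∈ Icc b₁ b₂ := ⟨le_rfl, hb₁₂.le⟩
  have m₂ : b₂ ∈ Icc b₁ b₂ := ⟨hb₁₂.le, le_rfl⟩
  have m₂' : b₂ ∈ Icc b₂ b₃ := ⟨le_rfl, hb₂₃.le⟩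
  have hrot := rayInt_comp_rotDil hχ b₁ b₂ (fun y => (α : ℂ) * U y)
    (fun y => conj (dd V₁ (-sin b₁, cos b₁) y))
  have hrotc : ContinuousOn (fun r : ℝ => U (r * cos b₂, r * sin b₂) *
      conj ((α : ℂ) * ((1 / χ₁₂ : ℝ) : ℂ) * dd V₁ (-sin b₁, cos b₁)
        (rotDil (1 / χ₁₂) (-(b₂ - b₁)) (r * cos b₂, r * sin b₂)))) (Ioi 0) := by
    refine (continuousOn_ray hb₁₂ m₂ hU₁.continuousOn).mul
      (Complex.continuous_conj.comp_continuousOn (continuousOn_const.mul ?_))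
    have h := (continuousOn_ray hb₁₂ m₁ (hV₁.dd (-sin b₁, cos b₁)).continuousOn).comp
      (f := fun r : ℝ => 1 / χ₁₂ * r) (s := Ioi 0) (by fun_prop)
      (fun r hr => mul_pos (one_div_pos.2 hχ) hr)
    simpa only [rotDil_polar, neg_sub, add_sub_cancel, Function.comp_def] using h
  have hroti := integrableOn_ray (h := fun y => U y *
      conj ((α : ℂ) * ((1 / χ₁₂ : ℝ) : ℂ) * dd V₁ (-sin b₁, cos b₁)
        (rotDil (1 / χ₁₂) (-(b₂ - b₁)) y))) hUc hU0 (fun y hy => by simp [hz y hy]) hrotc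
  have hroti' : IntegrableOn (fun r : ℝ => (α : ℂ) *
      U (rotDil χ₁₂ (b₂ - b₁) (r * cos b₁, r * sin b₁)) *
      conj (dd V₁ (-sin b₁, cos b₁) (r * cos b₁, r * sin b₁))) (Ioi 0) := by
    have h := (integrableOn_Ioi_comp_mul_left_iff _ 0 hχ).2 (by simpa only [mul_zero] using hroti)
    refine IntegrableOn.congr_fun (h.const_mul (χ₁₂ : ℂ)) (fun r _ => ?_) measurableSet_Ioi
    have e : 1 / χ₁₂ * (χ₁₂ * r) = r := by field_simp
    have e' : (χ₁₂ : ℂ) ≠ 0 := by exact_mod_cast hχ.ne'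
    simp only [rotDil_polar, e, add_sub_cancel, neg_sub, map_mul, Complex.conj_ofReal]
    push_cast
    field_simp
  have s₁ : rayInt b₁ (fun y => (U y + (α : ℂ) * U (rotDil χ₁₂ (b₂ - b₁) y)) *
      conj (dd V₁ (-sin b₁, cos b₁) y)) =
      rayInt b₁ (fun y => U y * conj (dd V₁ (-sin b₁, cos b₁) y)) +
      rayInt b₁ (fun y => (α : ℂ) * U (rotDil χ₁₂ (b₂ - b₁) y) *
        conj (dd V₁ (-sin b₁, cos b₁) y)) := by
    simp only [add_mul]
    exact integral_add (integrableOn_ray_mul hUc hU0 hz hb₁₂ m₁ hU₁.continuousOn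
      (hV₁.dd _).conj.continuousOn) hroti'
  have s₂ : rayInt b₂ (fun y => dd U (-sin b₂, cos b₂) y * (conj (V₁ y) - conj (V₂ y))) =
      rayInt b₂ (fun y => dd U (-sin b₂, cos b₂) y * conj (V₁ y)) -
      rayInt b₂ (fun y => dd U (-sin b₂, cos b₂) y * conj (V₂ y)) := by
    simp only [mul_sub]
    exact integral_sub
      (integrableOn_ray_mul hUc hU0 (hdz _) hb₁₂ m₂ (hU₁.dd _).continuousOn hV₁.conj.continuousOn)
      (integrableOn_ray_mul hUc hU0 (hdz _) hb₂₃ m₂' (hU₂.dd _).continuousOn hV₂.conj.continuousOn)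
  have s₃ : rayInt b₂ (fun y => U y * conj (dd V₁ (-sin b₂, cos b₂) y -
      dd V₂ (-sin b₂, cos b₂) y + (α : ℂ) * ((1 / χ₁₂ : ℝ) : ℂ) *
        dd V₁ (-sin b₁, cos b₁) (rotDil (1 / χ₁₂) (-(b₂ - b₁)) y))) =
      rayInt b₂ (fun y => U y * conj (dd V₁ (-sin b₂, cos b₂) y)) -
      rayInt b₂ (fun y => U y * conj (dd V₂ (-sin b₂, cos b₂) y)) +
      rayInt b₂ (fun y => U y * conj ((α : ℂ) * ((1 / χ₁₂ : ℝ) : ℂ) *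
        dd V₁ (-sin b₁, cos b₁) (rotDil (1 / χ₁₂) (-(b₂ - b₁)) y))) := by
    have i₁ := integrableOn_ray_mul hUc hU0 hz hb₁₂ m₂ hU₁.continuousOn
      (hV₁.dd (-sin b₂, cos b₂)).conj.continuousOn
    have i₂ := integrableOn_ray_mul hUc hU0 hz hb₂₃ m₂' hU₂.continuousOn
      (hV₂.dd (-sin b₂, cos b₂)).conj.continuousOn
    simp only [map_add, map_sub, mul_add, mul_sub, rayInt]
    rw [← integral_sub i₁ i₂]
    exact integral_add (i₁.sub i₂) hroti
  have hrot' : rayInt b₁ (fun y => (α : ℂ) * U (rotDil χ₁₂ (b₂ - b₁) y) *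
        conj (dd V₁ (-sin b₁, cos b₁) y)) =
      rayInt b₂ (fun y => U y * conj ((α : ℂ) * ((1 / χ₁₂ : ℝ) : ℂ) *
        dd V₁ (-sin b₁, cos b₁) (rotDil (1 / χ₁₂) (-(b₂ - b₁)) y))) := by
    rw [hrot]
    congr 1
    ext y
    simp only [map_mul, Complex.conj_ofReal]
    ring
  have hneg : ∀ (W : ℝ × ℝ → ℂ) (y : ℝ × ℝ),
      dd W (sin b₃, -cos b₃) y = -dd W (-sin b₃, cos b₃) y := fun W y => by
    rw [dd_mk, dd_mk W (-sin b₃)]; push_cast; ring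
  have n₁ : rayInt b₃ (fun y => U y * conj (dd V₂ (sin b₃, -cos b₃) y)) =
      -rayInt b₃ (fun y => U y * conj (dd V₂ (-sin b₃, cos b₃) y)) := by
    simp only [rayInt, hneg, map_neg, mul_neg, integral_neg]
  have n₂ : rayInt b₃ (fun y => dd U (sin b₃, -cos b₃) y * conj (V₂ y)) =
      -rayInt b₃ (fun y => dd U (-sin b₃, cos b₃) y * conj (V₂ y)) := by
    simp only [rayInt, hneg, neg_mul, integral_neg]
  rw [s₁, s₂, s₃, hrot', n₁, n₂]
  linear_combination key₁ + key₂
end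
end

section
/- Let U ∈ C₀^∞(K̄∖{0}) and V₁ ∈ C^∞(K̄₁∖{0}). Then the nonlocal normal-derivative boundary term on γ₁ can be rewritten, via change of variables and integration by parts along the ray, as a boundary term on γ₂: ∫_{γ₁} (∂U/∂n₁)·conj(V₁) dγ = ∫_{γ₁} ( ∂U/∂n₁ + α·(∂U/∂r)(χ₁₂ r, φ+φ₁₂) )·conj(V₁) dγ + ∫_{γ₂} U·α·(χ'₂₁)²·conj( (∂V₁/∂r)(χ'₂₁ r, φ+φ'₂₁) ) dγ. -/
open MeasureTheory Real Set ComplexConjugate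

noncomputable section

/-- The point with polar coordinates `(r, b)`. -/
def rayPoint (b r : ℝ) : ℝ × ℝ := (r * Real.cos b, r * Real.sin b)

theorem rayInt_eq (b : ℝ) (h : ℝ × ℝ → ℂ) :
    rayInt b h = ∫ r in Ioi (0 : ℝ), h (rayPoint b r) := rfl

theorem norm_rayPoint_lower (b r : ℝ) (hr : 0 ≤ r) : r ≤ 2 * ‖rayPoint b r‖ := by
  have h₁ := norm_fst_le (rayPoint b r)
  have h₂ := norm_snd_le (rayPoint b r)
  simp only [rayPoint, Real.norm_eq_abs, abs_mul, abs_of_nonneg hr] at h₁ h₂ ⊢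
  have h₃ : 1 ≤ |Real.cos b| + |Real.sin b| := by
    nlinarith [Real.sin_sq_add_cos_sq b, sq_abs (Real.sin b), sq_abs (Real.cos b),
      abs_nonneg (Real.sin b), abs_nonneg (Real.cos b), Real.abs_sin_le_one b,
      Real.abs_cos_le_one b]
  nlinarith

theorem rayPoint_ne_zero (b : ℝ) {r : ℝ} (hr : 0 < r) : rayPoint b r ≠ 0 := by
  intro h
  have := norm_rayPoint_lower b r hr.le
  rw [h, norm_zero] at this
  linarith

theorem hasDerivAt_rayPoint (b r : ℝ) :
    HasDerivAt (rayPoint b) (Real.cos b, Real.sin b) r := by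
  have h := ((hasDerivAt_id' r).mul_const (Real.cos b)).prodMk
    ((hasDerivAt_id' r).mul_const (Real.sin b))
  rw [one_mul, one_mul] at h
  exact h

theorem continuous_rayPoint (b : ℝ) : Continuous (rayPoint b) := by
  unfold rayPoint
  fun_prop

theorem continuous_rayPoint_angle (r : ℝ) : Continuous fun b => rayPoint b r := by
  unfold rayPoint
  fun_prop

theorem tendsto_rayPoint_nhdsGT_zero (b : ℝ) :
    Filter.Tendsto (rayPoint b) (nhdsWithin 0 (Ioi 0)) (nhds 0) := by
  have h := (continuous_rayPoint b).tendsto 0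
  have h0 : rayPoint b 0 = 0 := by simp [rayPoint]
  rw [h0] at h
  exact h.mono_left nhdsWithin_le_nhds

theorem tendsto_rayPoint_atTop (b : ℝ) :
    Filter.Tendsto (rayPoint b) Filter.atTop (Filter.cocompact (ℝ × ℝ)) := by
  rw [← Metric.cobounded_eq_cocompact, ← tendsto_norm_atTop_iff_cobounded]
  refine Filter.tendsto_atTop_mono' _ ?_ (Filter.tendsto_id.atTop_div_const (zero_lt_two' ℝ))
  filter_upwards [Filter.eventually_ge_atTop 0] with r hr
  have := norm_rayPoint_lower b r hr
  simp only [id]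
  linarith

theorem rotDil_rayPoint (χ ψ b r : ℝ) :
    rotDil χ ψ (rayPoint b r) = rayPoint (b + ψ) (χ * r) := by
  simp only [rotDil, rayPoint, Real.cos_add, Real.sin_add, Prod.mk.injEq]
  constructor <;> ring

theorem rayPoint_mem_closure_sector {a b θ r : ℝ} (hab : a < b) (hθ : θ ∈ Icc a b)
    (hr : 0 < r) : rayPoint θ r ∈ closure (sector a b) := by
  rw [← closure_Ioo hab.ne] at hθ
  have h : (fun b => rayPoint b r) '' Ioo a b ⊆ sector a b := by
    rintro _ ⟨φ, hφ, rfl⟩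
    exact ⟨r, φ, hr, hφ.1, hφ.2, rfl⟩
  exact closure_mono h (image_closure_subset_closure_image (continuous_rayPoint_angle r)
    ⟨θ, hθ, rfl⟩)

theorem SmoothNear.contDiffAt {W : ℝ × ℝ → ℂ} {s : Set (ℝ × ℝ)} (hW : SmoothNear W s)
    {y : ℝ × ℝ} (hy : y ∈ s) : ContDiffAt ℝ (⊤ : ℕ∞) W y := by
  obtain ⟨O, hO, hsO, h⟩ := hW
  exact h.contDiffAt (hO.mem_nhds (hsO hy))

theorem ContDiffAt.continuousAt_dd {W : ℝ × ℝ → ℂ} {y : ℝ × ℝ}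
    (hW : ContDiffAt ℝ (⊤ : ℕ∞) W y) (v : ℝ × ℝ) : ContinuousAt (dd W v) y := by
  have h : ContinuousAt (fderiv ℝ W) y :=
    (hW.fderiv_right (m := 0) (by simp)).continuousAt
  exact h.clm_apply continuousAt_const

theorem ContDiffAt.hasDerivAt_rayPoint {W : ℝ × ℝ → ℂ} {b r : ℝ}
    (hW : ContDiffAt ℝ (⊤ : ℕ∞) W (rayPoint b r)) :
    HasDerivAt (fun r => W (rayPoint b r)) (dd W (Real.cos b, Real.sin b) (rayPoint b r)) r :=
  ((hW.differentiableAt (by simp)).hasFDerivAt).comp_hasDerivAt r (_root_.hasDerivAt_rayPoint b r)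

theorem integrableOn_Ioi_of_eventually_eq_zero {h : ℝ → ℂ} (hc : ContinuousOn h (Ioi 0))
    (h0 : ∀ᶠ r in nhdsWithin 0 (Ioi 0), h r = 0) (h1 : ∀ᶠ r in Filter.atTop, h r = 0) :
    IntegrableOn h (Ioi 0) := by
  obtain ⟨a, ha, h0⟩ := mem_nhdsGT_iff_exists_Ioo_subset.mp h0
  obtain ⟨R, h1⟩ := Filter.eventually_atTop.mp h1
  have hi : IntegrableOn h (Icc a R) :=
    (hc.mono fun r hr => lt_of_lt_of_le ha hr.1).integrableOn_Icc
  refine hi.of_forall_sdiff_eq_zero measurableSet_Ioi ?_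
  rintro r ⟨hr, hr'⟩
  by_cases hra : r < a
  · exact h0 ⟨hr, hra⟩
  · exact h1 r (not_lt.mp fun hR => hr' ⟨not_lt.mp hra, hR.le⟩)

theorem eventually_rayPoint_nhdsGT_eq_zero {F : ℝ × ℝ → ℂ} (b : ℝ) {χ : ℝ} (hχ : 0 < χ)
    (hF0 : (0 : ℝ × ℝ) ∉ tsupport F) :
    ∀ᶠ r in nhdsWithin 0 (Ioi 0), F (rayPoint b (χ * r)) = 0 := by
  have hc : Filter.Tendsto (fun r => χ * r) (nhdsWithin 0 (Ioi 0)) (nhdsWithin 0 (Ioi 0)) := by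
    refine tendsto_nhdsWithin_iff.mpr ⟨?_, ?_⟩
    · have h := (continuous_const_mul χ).tendsto 0
      rw [mul_zero] at h
      exact h.mono_left nhdsWithin_le_nhds
    · filter_upwards [self_mem_nhdsWithin] with r hr using mul_pos hχ hr
  exact ((tendsto_rayPoint_nhdsGT_zero b).comp hc).eventually
    (notMem_tsupport_iff_eventuallyEq.mp hF0)

theorem eventually_rayPoint_atTop_eq_zero {F : ℝ × ℝ → ℂ} (b : ℝ) {χ : ℝ} (hχ : 0 < χ)
    (hFc : HasCompactSupport F) : ∀ᶠ r in Filter.atTop, F (rayPoint b (χ * r)) = 0 := by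
  have h := hasCompactSupport_iff_eventuallyEq.mp hFc
  rw [Filter.coclosedCompact_eq_cocompact] at h
  exact ((tendsto_rayPoint_atTop b).comp (Filter.tendsto_id.const_mul_atTop hχ)).eventually h

theorem tsupport_dd_subset (W : ℝ × ℝ → ℂ) (v : ℝ × ℝ) : tsupport (dd W v) ⊆ tsupport W := by
  refine (closure_mono fun y hy => ?_).trans (tsupport_fderiv_subset ℝ)
  contrapose! hy
  simp_all [dd]

theorem integrableOn_rayPoint_mul {F : ℝ × ℝ → ℂ} {g : ℝ → ℂ} {b χ : ℝ} (hχ : 0 < χ)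
    (hF : ∀ r > 0, ContinuousAt F (rayPoint b r)) (hFc : HasCompactSupport F)
    (hF0 : (0 : ℝ × ℝ) ∉ tsupport F) (hg : ContinuousOn g (Ioi 0)) :
    IntegrableOn (fun r => F (rayPoint b (χ * r)) * g r) (Ioi 0) := by
  refine integrableOn_Ioi_of_eventually_eq_zero (ContinuousOn.mul (fun r hr => ?_) hg) ?_ ?_
  · have h : ContinuousAt (fun r => rayPoint b (χ * r)) r :=
      ((continuous_rayPoint b).comp (continuous_const_mul χ)).continuousAt
    exact (ContinuousAt.comp (f := fun r => rayPoint b (χ * r)) (hF _ (mul_pos hχ hr))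
      h).continuousWithinAt
  · filter_upwards [eventually_rayPoint_nhdsGT_eq_zero b hχ hF0] with r hr
    rw [hr, zero_mul]
  · filter_upwards [eventually_rayPoint_atTop_eq_zero b hχ hFc] with r hr
    rw [hr, zero_mul]

/-- Integration by parts along rays, after a dilation of the argument of `U`. -/
theorem integral_dd_rayPoint_mul_conj {U V : ℝ × ℝ → ℂ} {b b' χ : ℝ} (hχ : 0 < χ)
    (hU : ∀ r > 0, ContDiffAt ℝ (⊤ : ℕ∞) U (rayPoint b r))
    (hV : ∀ r > 0, ContDiffAt ℝ (⊤ : ℕ∞) V (rayPoint b' r))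
    (hUc : HasCompactSupport U) (hU0 : (0 : ℝ × ℝ) ∉ tsupport U) :
    IntegrableOn (fun r => dd U (Real.cos b, Real.sin b) (rayPoint b (χ * r)) *
        conj (V (rayPoint b' r))) (Ioi 0) ∧
    ∫ r in Ioi (0 : ℝ), dd U (Real.cos b, Real.sin b) (rayPoint b (χ * r)) *
        conj (V (rayPoint b' r)) =
      -((((1 / χ) ^ 2 : ℝ) : ℂ) * ∫ r in Ioi (0 : ℝ), U (rayPoint b r) *
        conj (dd V (Real.cos b', Real.sin b') (rayPoint b' (1 / χ * r)))) := by
  have hint : IntegrableOn (fun r => dd U (Real.cos b, Real.sin b) (rayPoint b (χ * r)) *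
      conj (V (rayPoint b' r))) (Ioi 0) := by
    refine integrableOn_rayPoint_mul hχ (fun r hr => (hU r hr).continuousAt_dd _)
      (hUc.mono' ((subset_tsupport _).trans (tsupport_dd_subset U _)))
      (fun h => hU0 (tsupport_dd_subset U _ h)) ?_
    exact fun r hr => (Complex.continuous_conj.continuousAt.comp
      (hV r hr).hasDerivAt_rayPoint.continuousAt).continuousWithinAt
  have hint' : IntegrableOn (fun r => U (rayPoint b (χ * r)) *
      conj (dd V (Real.cos b', Real.sin b') (rayPoint b' r))) (Ioi 0) := by
    refine integrableOn_rayPoint_mul hχ (fun r hr => (hU r hr).continuousAt) hUc hU0 ?_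
    exact fun r hr => (Complex.continuous_conj.continuousAt.comp
      (ContinuousAt.comp (f := rayPoint b') ((hV r hr).continuousAt_dd _)
        (continuous_rayPoint b').continuousAt)).continuousWithinAt
  have hzero : ∀ l : Filter ℝ, (∀ᶠ r in l, U (rayPoint b (χ * r)) = 0) →
      Filter.Tendsto ((fun r => U (rayPoint b (χ * r))) * fun r => conj (V (rayPoint b' r)))
        l (nhds 0) := fun l hl => by
    refine tendsto_const_nhds.congr' ?_
    filter_upwards [hl] with r hr
    simp [hr]
  have hparts := integral_Ioi_mul_deriv_eq_deriv_mul (a := 0)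
    (u := fun r => U (rayPoint b (χ * r))) (v := fun r => conj (V (rayPoint b' r)))
    (u' := fun r => χ * dd U (Real.cos b, Real.sin b) (rayPoint b (χ * r)))
    (v' := fun r => conj (dd V (Real.cos b', Real.sin b') (rayPoint b' r)))
    (fun r hr => by
      have h := (hU (χ * r) (mul_pos hχ hr)).hasDerivAt_rayPoint.scomp r
        ((hasDerivAt_id' r).const_mul χ)
      simpa [Function.comp_def] using h)
    (fun r hr => (hV r hr).hasDerivAt_rayPoint.star)
    hint' (by simpa only [IntegrableOn, Pi.mul_def, mul_assoc] using hint.const_mul (χ : ℂ))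
    (hzero _ (eventually_rayPoint_nhdsGT_eq_zero b hχ hU0))
    (hzero _ (eventually_rayPoint_atTop_eq_zero b hχ hUc))
  have hsubst := integral_comp_mul_left_Ioi (fun s => U (rayPoint b s) *
    conj (dd V (Real.cos b', Real.sin b') (rayPoint b' (1 / χ * s)))) 0 hχ
  have hcancel : ∀ r, 1 / χ * (χ * r) = r := fun r => by field_simp
  have hχ' : (χ : ℂ) ≠ 0 := by exact_mod_cast hχ.ne'
  simp only [hcancel, mul_zero, Complex.real_smul, Complex.ofReal_inv] at hsubst
  simp only [mul_assoc, integral_const_mul, sub_self, zero_sub] at hparts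
  refine ⟨hint, ?_⟩
  rw [hsubst] at hparts
  push_cast
  field_simp at hparts ⊢
  linear_combination hparts

/-- Rewriting of the nonlocal Neumann-type boundary term on `γ₁` as a boundary term
on `γ₂` by the change of variables and integration by parts along the ray. -/
theorem nonlocal_term_change_of_variables_neumann
    (b₁ b₂ b₃ : ℝ) (hb₀ : 0 < b₁) (hb₁₂ : b₁ < b₂) (hb₂₃ : b₂ < b₃) (hb₃ : b₃ < 2 * π)
    (α χ₁₂ : ℝ) (hχ : 0 < χ₁₂)
    (U V₁ : ℝ × ℝ → ℂ)
    (hU : SmoothNear U (closure (sector b₁ b₃) \ {0}))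
    (hUc : HasCompactSupport U) (hU0 : (0 : ℝ × ℝ) ∉ tsupport U)
    (hV₁ : SmoothNear V₁ (closure (sector b₁ b₂) \ {0})) :
    rayInt b₁ (fun y => dd U (-Real.sin b₁, Real.cos b₁) y * conj (V₁ y)) =
    rayInt b₁ (fun y => (dd U (-Real.sin b₁, Real.cos b₁) y +
        (α : ℂ) * dd U (Real.cos b₂, Real.sin b₂) (rotDil χ₁₂ (b₂ - b₁) y)) * conj (V₁ y)) +
    rayInt b₂ (fun y => U y * (α : ℂ) * (((1 / χ₁₂ : ℝ) ^ 2 : ℝ) : ℂ) *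
      conj (dd V₁ (Real.cos b₁, Real.sin b₁) (rotDil (1 / χ₁₂) (-(b₂ - b₁)) y))) := by
  have hU' : ∀ b ∈ Icc b₁ b₃, ∀ r > 0, ContDiffAt ℝ (⊤ : ℕ∞) U (rayPoint b r) :=
    fun b hb r hr => hU.contDiffAt
      ⟨rayPoint_mem_closure_sector (hb₁₂.trans hb₂₃) hb hr, rayPoint_ne_zero b hr⟩
  have hV' : ∀ r > 0, ContDiffAt ℝ (⊤ : ℕ∞) V₁ (rayPoint b₁ r) := fun r hr =>
    hV₁.contDiffAt ⟨rayPoint_mem_closure_sector hb₁₂ (left_mem_Icc.mpr hb₁₂.le) hr,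
      rayPoint_ne_zero b₁ hr⟩
  obtain ⟨hint, hparts⟩ := integral_dd_rayPoint_mul_conj hχ
    (hU' b₂ ⟨hb₁₂.le, hb₂₃.le⟩) hV' hUc hU0
  have hnormal : IntegrableOn (fun r => dd U (-Real.sin b₁, Real.cos b₁) (rayPoint b₁ (1 * r)) *
      conj (V₁ (rayPoint b₁ r))) (Ioi 0) := by
    refine integrableOn_rayPoint_mul one_pos
      (fun r hr => (hU' b₁ ⟨le_rfl, (hb₁₂.trans hb₂₃).le⟩ r hr).continuousAt_dd _)
      (hUc.mono' ((subset_tsupport _).trans (tsupport_dd_subset U _)))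
      (fun h => hU0 (tsupport_dd_subset U _ h)) ?_
    exact fun r hr => (Complex.continuous_conj.continuousAt.comp
      (hV' r hr).hasDerivAt_rayPoint.continuousAt).continuousWithinAt
  simp only [one_mul] at hnormal
  have hsplit := integral_add hnormal (hint.const_mul (α : ℂ))
  have hrewrite : ∀ r, U (rayPoint b₂ r) * (α : ℂ) * (((1 / χ₁₂ : ℝ) ^ 2 : ℝ) : ℂ) *
      conj (dd V₁ (Real.cos b₁, Real.sin b₁) (rayPoint b₁ (1 / χ₁₂ * r))) =
      (α : ℂ) * (((1 / χ₁₂ : ℝ) ^ 2 : ℝ) : ℂ) * (U (rayPoint b₂ r) *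
        conj (dd V₁ (Real.cos b₁, Real.sin b₁) (rayPoint b₁ (1 / χ₁₂ * r)))) :=
    fun r => by ring
  simp only [rayInt_eq, rotDil_rayPoint, add_sub_cancel, neg_sub, hrewrite, add_mul,
    integral_const_mul] at hsplit ⊢
  simp only [mul_assoc] at hsplit ⊢
  rw [hsplit, hparts]
  ring
end
end
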